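/- Let n ≥ 1 and let ν : ℙ¹(ℂ) → ℕ be any function. Then the set of points of 𝒳_n represented by classes [P:Q] ∈ F_n such that defect(c) = ν(c) for every c ∈ ℙ¹(ℂ) is finite. In other words, the Lyashko–Looijenga map, which assigns to an orbit of rational functions of degree n its set of critical values with multiplicities, has finite fibers on 𝒳_n. -/

import Mathlib

/-!
Setup: for `n ≥ 1`, a rational function of degree `n` on `ℂP¹` is represented by a
coprime pair `(a, b)` of binary forms of degree `n` in variables `x₀, x₁`.  A binary form
of degree `n` is encoded by its coefficient vector `Fin (n+1) → ℂ`, the form being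
`∑ i, a i * x₀ ^ i * x₁ ^ (n - i)`; thus the pair space is the `(2n+2)`-dimensional
complex vector space `(Fin (n+1) → ℂ) × (Fin (n+1) → ℂ)` with its standard (coefficient)
topology.  `F_n` is the space of classes `[a : b]` of coprime pairs up to simultaneous
scaling (a subspace of `ℂP^{2n+1}`, here constructed directly as the quotient of the
coprime pairs by scaling, with the quotient topology — which agrees with the subspace
topology since the projectivization map is open and the coprime locus is saturated).
`PGL(2,ℂ)` acts on `F_n` on the right by precomposition `[a : b] · g = [a ∘ g : b ∘ g]`,
`(a ∘ g)(x) = a (x g)`; since scalar matrices act trivially on `F_n`, the orbit space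
`𝒳_n = F_n / PGL(2,ℂ)` coincides with the quotient of `F_n` by the (right) action of
`GL(2,ℂ)` by substitution, which is how we construct it.  `𝒳_n` carries the quotient
topology and `pr : F_n → 𝒳_n` is the quotient map.
-/

open Filter Topology

noncomputable section

/-- Coefficient vector of a binary form of degree `n` in `x₀, x₁`. -/
abbrev Coeffs (n : ℕ) := Fin (n + 1) → ℂ

/-- Value of the binary form with coefficient vector `a` at the point `x = (x 0, x 1)`. -/
def evalForm {n : ℕ} (a : Coeffs n) (x : Fin 2 → ℂ) : ℂ :=
  ∑ i : Fin (n + 1), a i * x 0 ^ (i : ℕ) * x 1 ^ (n - (i : ℕ))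

/-- Two binary forms of degree `n` are coprime iff they have no common zero in `ℂ² \ {0}`. -/
def IsCoprimePair {n : ℕ} (a b : Coeffs n) : Prop :=
  ∀ x : Fin 2 → ℂ, x ≠ 0 → (evalForm a x ≠ 0 ∨ evalForm b x ≠ 0)

/-- The space of coprime pairs of binary forms of degree `n`
(a subspace of the `(2n+2)`-dimensional coefficient space). -/
abbrev RatRep (n : ℕ) := { v : Coeffs n × Coeffs n // IsCoprimePair v.1 v.2 }

/-- Simultaneous rescaling of a coprime pair. -/
def scaleRel (n : ℕ) (u v : RatRep n) : Prop := ∃ c : ℂˣ, v.val = c • u.val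

/-- `F_n`: the space of rational functions `[a : b]` of degree `n`, i.e. coprime pairs of
degree-`n` binary forms up to simultaneous scaling, with the quotient (= coefficient)
topology. -/
abbrev Fn (n : ℕ) := Quot (scaleRel n)

open MvPolynomial in
/-- The binary form (as a polynomial in `MvPolynomial (Fin 2) ℂ`) with coefficient
vector `a`. -/
def toPoly {n : ℕ} (a : Coeffs n) : MvPolynomial (Fin 2) ℂ :=
  ∑ i : Fin (n + 1), C (a i) * X 0 ^ (i : ℕ) * X 1 ^ (n - (i : ℕ))

/-- The coefficient vector of (the degree-`n` homogeneous part of) a polynomial in two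
variables. -/
def ofPoly (n : ℕ) (p : MvPolynomial (Fin 2) ℂ) : Coeffs n :=
  fun j => MvPolynomial.coeff (Finsupp.single 0 (j : ℕ) + Finsupp.single 1 (n - (j : ℕ))) p

/-- Right substitution action: the coefficient vector of `a ∘ g`, where
`(a ∘ g)(x) = a (x g)`, i.e. the substitution `xⱼ ↦ ∑ i, g i j * xᵢ`. -/
def compForm {n : ℕ} (a : Coeffs n) (g : Matrix (Fin 2) (Fin 2) ℂ) : Coeffs n :=
  ofPoly n (MvPolynomial.bind₁
    (fun j => ∑ i : Fin 2, MvPolynomial.C (g i j) * MvPolynomial.X i) (toPoly a))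

/-- `p` and `q` in `F_n` are related iff `q = p · g` for some `g ∈ GL(2,ℂ)`; the orbits of
this relation are exactly the orbits of the right `PGL(2,ℂ)`-action on `F_n`. -/
def glRel (n : ℕ) (p q : Fn n) : Prop :=
  ∃ (u v : RatRep n) (g : GL (Fin 2) ℂ),
    Quot.mk (scaleRel n) u = p ∧ Quot.mk (scaleRel n) v = q ∧
    v.val = (compForm u.val.1 g.val, compForm u.val.2 g.val)

/-- The moduli space `𝒳_n = F_n / PGL(2,ℂ)` with the quotient topology. -/
abbrev Xn (n : ℕ) := Quot (glRel n)

/-- The quotient map `pr : F_n → 𝒳_n`. -/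
def pr (n : ℕ) : Fn n → Xn n := Quot.mk (glRel n)

/-- The fiber of the rational map `[P : Q] : ℙ¹(ℂ) → ℙ¹(ℂ)` over the point
`c = [c₀ : c₁]`: the set of `[x₀ : x₁]` with `c₁ · P(x₀,x₁) - c₀ · Q(x₀,x₁) = 0`
(a condition invariant under rescaling of both `c` and `x`, so it may be tested on the
chosen representatives `rep`). -/
def fiberSet {n : ℕ} (P Q : Coeffs n) (c : Projectivization ℂ (Fin 2 → ℂ)) :
    Set (Projectivization ℂ (Fin 2 → ℂ)) :=
  { x | c.rep 1 * evalForm P x.rep - c.rep 0 * evalForm Q x.rep = 0 }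

/-- The defect (= multiplicity as a critical value) of `c ∈ ℙ¹(ℂ)` for the degree-`n`
branched covering `[P : Q]`: `n` minus the number of points of the fiber over `c`. -/
def defect {n : ℕ} (P Q : Coeffs n) (c : Projectivization ℂ (Fin 2 → ℂ)) : ℕ :=
  n - (fiberSet P Q c).ncard

section NormalizedPairs

open Polynomial

theorem formallySmooth_of_charZero (F K : Type*) [Field F] [Field K] [Algebra F K] [CharZero F] :
    Algebra.FormallySmooth F K := by
  obtain ⟨s, hs⟩ := exists_isTranscendenceBasis F K
  have h := hs.isAlgebraic_field
  have : Algebra.IsSeparable (IntermediateField.adjoin F (Set.range ((↑) : s → K))) K :=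
    inferInstance
  exact Algebra.FormallySmooth.of_algebraicIndependent_of_isSeparable hs.1

theorem Algebra.FormallySmooth.exists_ringHom_section {A K B : Type*} [CommRing A] [CommRing K]
    [CommRing B] [Algebra A K] [Algebra.FormallySmooth A K] (g : A →+* B) (p : B →+* K)
    (hp : Function.Surjective p) (hker : IsNilpotent (RingHom.ker p))
    (h : p.comp g = algebraMap A K) :
    ∃ f : K →+* B, p.comp f = RingHom.id K ∧ f.comp (algebraMap A K) = g := by
  let : Algebra A B := g.toAlgebra
  let p' : B →ₐ[A] K := { p with commutes' := fun a => RingHom.congr_fun h a }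
  let f := Algebra.FormallySmooth.liftOfSurjective (AlgHom.id A K) p' hp hker
  exact ⟨f, RingHom.ext fun x =>
    Algebra.FormallySmooth.liftOfSurjective_apply (AlgHom.id A K) p' hp hker x, f.comp_algebraMap⟩

theorem exists_derivation_eq_one {k K : Type*} [Field k] [CharZero k] [Field K] [Algebra k K] {x : K}
    (hx : Transcendental k x) : ∃ d : Derivation k K K, d x = 1 := by
  let : Algebra k[X] K := (aeval x).toAlgebra
  have : FaithfulSMul k[X] K :=
    (faithfulSMul_iff_algebraMap_injective _ _).2 (transcendental_iff_injective.1 hx)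
  have : IsScalarTower k k[X] K := IsScalarTower.of_algebraMap_eq' (aeval x).comp_algebraMap.symm
  let : Algebra (FractionRing k[X]) K := FractionRing.liftAlgebra k[X] K
  have : Algebra.FormallySmooth k[X] (FractionRing k[X]) := inferInstance
  have : CharZero (FractionRing k[X]) := inferInstance
  have : Algebra.FormallySmooth (FractionRing k[X]) K := formallySmooth_of_charZero _ _
  have : Algebra.FormallySmooth k[X] K := .comp k[X] (FractionRing k[X]) K
  let p : DualNumber K →+* K := (TrivSqZeroExt.fstHom K K K).toRingHom
  let g : k[X] →+* DualNumber K :=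
    (aeval (TrivSqZeroExt.inl x + TrivSqZeroExt.inr 1 : DualNumber K)).toRingHom
  obtain ⟨f, hf, hfg⟩ := Algebra.FormallySmooth.exists_ringHom_section g p
    (fun y => ⟨TrivSqZeroExt.inl y, rfl⟩) ⟨2, by
      change _ ^ 2 = ⊥
      exact TrivSqZeroExt.kerIdeal_sq K K⟩ (by
      change _ = (aeval x).toRingHom
      ext y <;> simp [p, g])
  have hfst (y : K) : (f y).fst = y := RingHom.congr_fun hf y
  have hfk (c : k) : f (algebraMap k K c) = algebraMap k (DualNumber K) c := by
    rw [IsScalarTower.algebraMap_apply k k[X] K]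
    exact (RingHom.congr_fun hfg _).trans (aeval_C _ _)
  refine ⟨Derivation.mk' ⟨⟨fun y => (f y).snd, fun y z => by simp⟩, fun c y => ?_⟩ fun y z => ?_, ?_⟩
  · simp [Algebra.smul_def, hfk, hfst, TrivSqZeroExt.algebraMap_eq_inl']
  · simp [hfst, mul_comm]
  · have : f x = TrivSqZeroExt.inl x + TrivSqZeroExt.inr 1 := by
      have := RingHom.congr_fun hfg X
      simpa [g, RingHom.algebraMap_toAlgebra] using this
    simp [this]

theorem mem_range_algebraMap_of_derivation_eq_zero {k K : Type*} [Field k] [CharZero k]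
    [IsAlgClosed k] [Field K] [Algebra k K] {x : K} (h : ∀ d : Derivation k K K, d x = 0) :
    x ∈ (algebraMap k K).range := by
  have hx : IsAlgebraic k x := by
    by_contra hx
    obtain ⟨d, hd⟩ := exists_derivation_eq_one hx
    exact zero_ne_one ((h d).symm.trans hd)
  exact minpoly.mem_range_of_degree_eq_one k x
    (IsAlgClosed.degree_eq_one_of_irreducible k (minpoly.irreducible hx.isIntegral))

theorem Derivation.pow_pred_dvd {A : Type*} [CommRing A] (δ : Derivation ℤ A A) {p a : A} {e : ℕ}
    (h : p ^ e ∣ a) : p ^ (e - 1) ∣ δ a := by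
  obtain ⟨u, rfl⟩ := h
  rw [δ.leibniz, δ.leibniz_pow]
  refine dvd_add (dvd_mul_of_dvd_left (pow_dvd_pow p (Nat.sub_le e 1)) _) ?_
  simp only [smul_eq_mul, nsmul_eq_mul]
  exact ⟨u * (e * δ p), by ring⟩

theorem Polynomial.not_pow_dvd_derivative {K : Type*} [Field K] [CharZero K] {π R : K[X]}
    (hπ : Irreducible π) {e : ℕ} (he : e ≠ 0) (h : π ^ e ∣ R) (h' : ¬ π ^ (e + 1) ∣ R) :
    ¬ π ^ e ∣ derivative R := by
  obtain ⟨e, rfl⟩ := Nat.exists_eq_succ_of_ne_zero he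
  obtain ⟨u, rfl⟩ := h
  rintro ⟨v, hv⟩
  have hprime := hπ.prime
  have hd : π ∣ derivative π * u := by
    have : C ((e : K) + 1) * (derivative π * u) = π * (v - derivative u) := by
      refine mul_left_cancel₀ (pow_ne_zero e hπ.ne_zero) ?_
      simp only [derivative_mul, derivative_pow, Nat.succ_eq_add_one, Nat.add_sub_cancel,
        Nat.cast_add, Nat.cast_one] at hv
      linear_combination hv
    have hu : IsUnit (C ((e : K) + 1)) :=
      isUnit_C.2 (isUnit_iff_ne_zero.2 (Nat.cast_add_one_ne_zero e))
    exact hu.dvd_mul_left.1 ⟨_, this⟩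
  rcases hprime.dvd_or_dvd hd with hd | hd
  · exact hπ.not_isUnit (hπ.separable.isUnit_of_dvd' dvd_rfl hd)
  · exact h' (by rw [pow_succ]; exact mul_dvd_mul_left _ hd)

theorem Polynomial.wronskian_dvd_of_derivation {K : Type*} [Field K] [CharZero K]
    (δ : Derivation ℤ K[X] K[X]) {P Q : K[X]} (hPQ : IsCoprime P Q) (hW : wronskian P Q ≠ 0)
    {ι : Type*} (s : Finset ι) (c : ι → K × K) (hc : ∀ i ∈ s, c i ≠ 0)
    (hδ : ∀ i ∈ s, δ (C (c i).1) = 0 ∧ δ (C (c i).2) = 0) {M : ℕ}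
    (hdvd : wronskian P Q ∣ (∏ i ∈ s, (C (c i).2 * P - C (c i).1 * Q)) ^ M) :
    wronskian P Q ∣ P * δ Q - δ P * Q := by
  rw [UniqueFactorizationMonoid.dvd_iff_emultiplicity_le hW]
  intro π hπ
  rw [emultiplicity_le_emultiplicity_iff]
  intro j hj
  rcases Nat.eq_zero_or_pos j with rfl | hj0
  · simp
  obtain ⟨i, hi, hiR⟩ := hπ.exists_mem_finset_dvd
    (hπ.dvd_of_dvd_pow ((dvd_pow_self π hj0.ne').trans (hj.trans hdvd)))
  obtain ⟨hδ1, hδ2⟩ := hδ i hi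
  have hci := hc i hi
  generalize c i = b at *
  obtain ⟨b₀, b₁⟩ := b
  dsimp only at *
  set R := C b₁ * P - C b₀ * Q with hR
  have hb : b₀ ≠ 0 ∨ b₁ ≠ 0 := by
    by_contra! h
    exact hci (by simp [h.1, h.2])
  have e0 : P * derivative R - derivative P * R = - C b₀ * wronskian P Q := by
    simp only [hR, wronskian, derivative_sub, derivative_C_mul]; ring
  have e1 : Q * derivative R - derivative Q * R = - C b₁ * wronskian P Q := by
    simp only [hR, wronskian, derivative_sub, derivative_C_mul]; ring
  have f0 : P * δ R - δ P * R = - C b₀ * (P * δ Q - δ P * Q) := by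
    simp only [hR, map_sub, δ.leibniz, hδ1, hδ2, smul_eq_mul]; ring
  have f1 : Q * δ R - δ Q * R = - C b₁ * (P * δ Q - δ P * Q) := by
    simp only [hR, map_sub, δ.leibniz, hδ1, hδ2, smul_eq_mul]; ring
  have dvd_of {b : K} (hb : b ≠ 0) {p x : K[X]} (h : p ∣ - C b * x) : p ∣ x := by
    rw [neg_mul, dvd_neg] at h
    exact (isUnit_C.2 (isUnit_iff_ne_zero.2 hb)).dvd_mul_left.1 h
  have hR0 : R ≠ 0 := by
    intro h0
    simp only [h0, derivative_zero, mul_zero, sub_zero] at e0 e1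
    rcases hb with hb | hb
    · exact hW (zero_dvd_iff.1 (dvd_of hb (zero_dvd_iff.2 e0.symm)))
    · exact hW (zero_dvd_iff.1 (dvd_of hb (zero_dvd_iff.2 e1.symm)))
  have hfin : FiniteMultiplicity π R := .of_not_isUnit hπ.not_isUnit hR0
  have hle := pow_multiplicity_dvd π R
  have hmax : ¬ π ^ (multiplicity π R + 1) ∣ R :=
    hfin.not_pow_dvd_of_multiplicity_lt (Nat.lt_succ_self _)
  have hne : multiplicity π R ≠ 0 := fun h => hmax (by simpa [h] using hiR)
  generalize multiplicity π R = e at *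
  have hje : j ≤ e - 1 := by
    by_contra! h
    have hWe : π ^ e ∣ wronskian P Q := (pow_dvd_pow π (by omega)).trans hj
    refine Polynomial.not_pow_dvd_derivative hπ.irreducible hne hle hmax ?_
    obtain ⟨A, B, hAB⟩ := hPQ
    have : derivative R = (A * derivative P + B * derivative Q) * R
        - (A * C b₀ + B * C b₁) * wronskian P Q := by
      linear_combination A * e0 + B * e1 - derivative R * hAB
    rw [this]
    exact dvd_sub (hle.mul_left _) (hWe.mul_left _)
  refine (pow_dvd_pow π hje).trans ?_
  have hδR := δ.pow_pred_dvd hle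
  have hle' := (pow_dvd_pow π (Nat.sub_le e 1)).trans hle
  rcases hb with hb | hb
  · exact dvd_of hb (f0 ▸ dvd_sub (hδR.mul_left _) (hle'.mul_left _))
  · exact dvd_of hb (f1 ▸ dvd_sub (hδR.mul_left _) (hle'.mul_left _))

/-- A rational function `P / Q` of degree `m + 1` with values `t 0`, `t 1`, `t 2` at the noncritical
points `∞`, `0`, `1`, and all of whose critical values are among the points `[c i]` for `i ∈ s`. -/
structure IsNormalizedPair {K ι : Type*} [Field K] (m M : ℕ) (t : Fin 3 → K) (s : Finset ι)
    (c : ι → K × K) (P Q : K[X]) : Prop where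
  natDegree_le : P.natDegree ≤ m + 1
  coeff_eq : P.coeff (m + 1) = t 0
  monic : Q.Monic
  natDegree_eq : Q.natDegree = m + 1
  eval_zero : P.eval 0 = t 1 * Q.eval 0
  eval_one : P.eval 1 = t 2 * Q.eval 1
  isCoprime : IsCoprime P Q
  wronskian_eval_zero : (wronskian P Q).eval 0 ≠ 0
  wronskian_eval_one : (wronskian P Q).eval 1 ≠ 0
  wronskian_coeff : (wronskian P Q).coeff (2 * m) ≠ 0
  wronskian_dvd : wronskian P Q ∣ (∏ i ∈ s, (C (c i).2 * P - C (c i).1 * Q)) ^ M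

/-- A rational function normalized at three points, with constant critical values, has constant
coefficients. -/
theorem IsNormalizedPair.deriv_coeff_eq_zero {K ι : Type*} [Field K] [CharZero K] [Differential K]
    {P Q : K[X]} {m M : ℕ} {t : Fin 3 → K} {s : Finset ι} {c : ι → K × K}
    (h : IsNormalizedPair m M t s c P Q) (ht : ∀ i, Differential.deriv (t i) = 0)
    (hc : ∀ i ∈ s, c i ≠ 0)
    (hδ : ∀ i ∈ s, Differential.deriv (c i).1 = 0 ∧ Differential.deriv (c i).2 = 0) (i : ℕ) :
    Differential.deriv (P.coeff i) = 0 ∧ Differential.deriv (Q.coeff i) = 0 := by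
  obtain ⟨hP, hPm, hQ, hQm, h0, h1, hPQ, hW0, hW1, hWm, hdvd⟩ := h
  have hW : wronskian P Q ≠ 0 := fun h => hWm (by simp [h])
  let δ : Derivation ℤ K[X] K[X] := Differential.mapCoeffs
  have hev (x : K) (hx : Differential.deriv x = 0) (p : K[X]) :
      (δ p).eval x = Differential.deriv (p.eval x) := by
    have := Differential.deriv_aeval_eq x p
    simp only [coe_aeval_eq_eval, hx, mul_zero, add_zero] at this
    exact this.symm
  obtain ⟨V, hV⟩ := wronskian_dvd_of_derivation δ hPQ hW s c hc (M := M)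
    (fun i hi => by simp [δ, hδ i hi]) hdvd
  have hδP : (δ P).natDegree ≤ m := by
    refine natDegree_le_iff_coeff_eq_zero.2 fun k hk => ?_
    change Differential.deriv (P.coeff k) = 0
    rcases (Nat.succ_le_of_lt hk).eq_or_lt with rfl | hk
    · rw [Nat.succ_eq_add_one, hPm, ht]
    · rw [coeff_eq_zero_of_natDegree_lt (by omega), map_zero]
  have hδQ : (δ Q).natDegree ≤ m := by
    refine natDegree_le_iff_coeff_eq_zero.2 fun k hk => ?_
    change Differential.deriv (Q.coeff k) = 0
    rcases (Nat.succ_le_of_lt hk).eq_or_lt with rfl | hk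
    · rw [Nat.succ_eq_add_one, ← hQm, hQ.coeff_natDegree, Derivation.map_one_eq_zero]
    · rw [coeff_eq_zero_of_natDegree_lt (by omega), map_zero]
  have hVdeg : V.natDegree ≤ 1 := by
    by_cases hV0 : V = 0
    · simp [hV0]
    have h1 : (P * δ Q - δ P * Q).natDegree ≤ 2 * m + 1 := by
      have hD := natDegree_sub_le_of_le (natDegree_mul_le_of_le hP hδQ)
        (natDegree_mul_le_of_le hδP hQm.le)
      omega
    rw [hV, natDegree_mul hW hV0] at h1
    have := le_natDegree_of_ne_zero hWm
    omega
  have hroot (x b : K) (hx : Differential.deriv x = 0) (hb : Differential.deriv b = 0)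
      (hxb : P.eval x = b * Q.eval x) (hWx : (wronskian P Q).eval x ≠ 0) : V.eval x = 0 := by
    have h := congrArg (eval x) hV
    simp only [eval_sub, eval_mul, hev x hx, hxb, Derivation.leibniz, hb, smul_eq_mul] at h
    refine (mul_eq_zero.1 (h.symm.trans ?_)).resolve_left hWx
    ring
  have hV0 := hroot 0 _ (map_zero _) (ht 1) h0 hW0
  have hV1 := hroot 1 _ (Derivation.map_one_eq_zero _) (ht 2) h1 hW1
  have hVz : V = 0 := by
    rw [eq_X_add_C_of_natDegree_le_one hVdeg] at hV0 hV1 ⊢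
    simp only [eval_add, eval_mul, eval_C, eval_X, mul_zero, zero_add, mul_one] at hV0 hV1
    simp_all
  rw [hVz, mul_zero, sub_eq_zero] at hV
  have hQz : δ Q = 0 := by
    by_contra hne
    have h2 : Q ∣ δ Q := hPQ.symm.dvd_of_dvd_mul_left ⟨δ P, by rw [hV, mul_comm]⟩
    have := natDegree_le_of_dvd h2 hne
    omega
  have hPz : δ P = 0 := by
    rw [hQz, mul_zero, eq_comm] at hV
    exact (mul_eq_zero.1 hV).resolve_right hQ.ne_zero
  exact ⟨congrArg (coeff · i) hPz, congrArg (coeff · i) hQz⟩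

theorem IsNormalizedPair.coeff_mem_range {k K ι : Type*} [Field k] [CharZero k] [IsAlgClosed k]
    [Field K] [Algebra k K] {P Q : K[X]} {m M : ℕ} {t : Fin 3 → k} {s : Finset ι} {c : ι → k × k}
    (hc : ∀ i ∈ s, c i ≠ 0)
    (h : IsNormalizedPair m M (fun i => algebraMap k K (t i)) s
      (fun i => (algebraMap k K (c i).1, algebraMap k K (c i).2)) P Q) (i : ℕ) :
    P.coeff i ∈ (algebraMap k K).range ∧ Q.coeff i ∈ (algebraMap k K).range := by
  have : CharZero K := charZero_of_injective_algebraMap (algebraMap k K).injective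
  have key (d : Derivation k K K) : d (P.coeff i) = 0 ∧ d (Q.coeff i) = 0 := by
    let : Differential K := ⟨d.restrictScalars ℤ⟩
    refine h.deriv_coeff_eq_zero (fun i => d.map_algebraMap _) (fun i hi h0 => hc i hi ?_)
      (fun i _ => ⟨d.map_algebraMap _, d.map_algebraMap _⟩) i
    simpa [Prod.ext_iff] using h0
  exact ⟨mem_range_algebraMap_of_derivation_eq_zero fun d => (key d).1,
    mem_range_algebraMap_of_derivation_eq_zero fun d => (key d).2⟩

theorem Polynomial.ext_of_map_evalRingHom {R : Type*} [CommRing R] {p q : (ℕ → R)[X]}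
    (h : ∀ n, p.map (Pi.evalRingHom (fun _ => R) n) = q.map (Pi.evalRingHom (fun _ => R) n)) :
    p = q := by
  ext i n
  simpa using congrArg (coeff · i) (h n)

theorem Polynomial.exists_forall_map_evalRingHom_eq {R : Type*} [CommRing R] {d : ℕ} (p : ℕ → R[X])
    (hp : ∀ n, (p n).natDegree ≤ d) : ∃ q : (ℕ → R)[X],
      q.natDegree ≤ d ∧ ∀ n, q.map (Pi.evalRingHom (fun _ => R) n) = p n := by
  refine ⟨∑ i ∈ Finset.range (d + 1), C (fun n => (p n).coeff i) * X ^ i,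
    natDegree_sum_le_of_forall_le _ _ fun i hi => ?_, fun n => ?_⟩
  · exact (natDegree_C_mul_X_pow_le _ _).trans (Finset.mem_range_succ_iff.1 hi)
  · conv_rhs => rw [as_sum_range_C_mul_X_pow' _ (Nat.lt_succ_of_le (hp n))]
    simp [Polynomial.map_sum]

theorem Polynomial.wronskian_map {R S : Type*} [CommRing R] [CommRing S] (f : R →+* S) (p q : R[X]) :
    wronskian (p.map f) (q.map f) = (wronskian p q).map f := by
  simp [wronskian, derivative_map]

theorem Polynomial.Monic.exists_bezout_natDegree_le {k : Type*} [Field k] {P Q : k[X]} {d : ℕ}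
    (hQ : Q.Monic) (hPd : P.natDegree ≤ d) (hQd : Q.natDegree ≤ d) (h : IsCoprime P Q) :
    ∃ A B : k[X], A.natDegree ≤ d ∧ B.natDegree ≤ 2 * d ∧ A * P + B * Q = 1 := by
  obtain ⟨A, B, hAB⟩ := h
  have hA : (A %ₘ Q).natDegree ≤ d := (natDegree_modByMonic_le _ hQ).trans hQd
  refine ⟨A %ₘ Q, B + (A /ₘ Q) * P, hA, ?_, ?_⟩
  · have hB : (B + (A /ₘ Q) * P) * Q = 1 - (A %ₘ Q) * P := by
      rw [modByMonic_eq_sub_mul_div]; linear_combination hAB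
    have := natDegree_sub_le_of_le (m := 2 * d) (n := 2 * d) (p := (1 : k[X])) (by simp)
      ((natDegree_mul_le_of_le hA hPd).trans (two_mul d).ge)
    rw [← hB, mul_comm, max_self] at this
    rcases eq_or_ne (B + (A /ₘ Q) * P) 0 with h0 | h0
    · simp [h0]
    · rw [hQ.natDegree_mul' h0] at this
      omega
  · rw [modByMonic_eq_sub_mul_div]; linear_combination hAB

theorem IsNormalizedPair.finite {k ι : Type*} [Field k] [CharZero k] [IsAlgClosed k] (m M : ℕ)
    (t : Fin 3 → k) (s : Finset ι) (c : ι → k × k) (hc : ∀ i ∈ s, c i ≠ 0) :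
    {p : k[X] × k[X] | IsNormalizedPair m M t s c p.1 p.2}.Finite := by
  by_contra hinf
  let f := Set.Infinite.natEmbedding _ hinf
  have hf (n : ℕ) : IsNormalizedPair m M t s c (f n).1.1 (f n).1.2 := (f n).2
  let φ : Ultrafilter ℕ := hyperfilter ℕ
  let γ : (ℕ → k) →+* Germ (φ : Filter ℕ) k := Germ.coeRingHom _
  have γ_eq (a b : ℕ → k) : γ a = γ b ↔ ∀ᶠ n in φ, a n = b n := Germ.coe_eq
  have γ_ne {a : ℕ → k} (ha : ∀ n, a n ≠ 0) : γ a ≠ 0 := by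
    rw [← map_zero γ, Ne, γ_eq]
    intro h
    obtain ⟨n, hn⟩ := h.exists
    exact ha n hn
  let ev (n : ℕ) : (ℕ → k) →+* k := Pi.evalRingHom (fun _ => k) n
  let : Algebra k (Germ (φ : Filter ℕ) k) := (γ.comp (Pi.constRingHom ℕ k)).toAlgebra
  have hconst (a : k) : algebraMap k (Germ (φ : Filter ℕ) k) a = γ (fun _ => a) := rfl
  obtain ⟨P, hPd, hP⟩ := exists_forall_map_evalRingHom_eq (fun n => (f n).1.1)
    fun n => (hf n).natDegree_le
  obtain ⟨Q, hQd, hQ⟩ := exists_forall_map_evalRingHom_eq (fun n => (f n).1.2)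
    fun n => (hf n).natDegree_eq.le
  choose A' B' hA' hB' hAB' using fun n => (hf n).monic.exists_bezout_natDegree_le
    (hf n).natDegree_le (hf n).natDegree_eq.le (hf n).isCoprime
  obtain ⟨A, -, hA⟩ := exists_forall_map_evalRingHom_eq A' hA'
  obtain ⟨B, -, hB⟩ := exists_forall_map_evalRingHom_eq B' hB'
  have hAB : A * P + B * Q = 1 := ext_of_map_evalRingHom fun n => by
    simp [hA, hB, hP, hQ, hAB']
  have hZ (n : ℕ) : ((∏ i ∈ s, (C (c i).2 * (f n).1.1 - C (c i).1 * (f n).1.2)) ^ M).natDegree ≤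
      M * (s.card * (m + 1)) := by
    refine natDegree_pow_le_of_le _ ((natDegree_prod_le _ _).trans ?_)
    refine (Finset.sum_le_card_nsmul s _ (m + 1) fun i _ => ?_)
    simpa using natDegree_sub_le_of_le ((natDegree_C_mul_le _ _).trans (hf n).natDegree_le)
      ((natDegree_C_mul_le _ _).trans (hf n).natDegree_eq.le)
  have hT (n : ℕ) : ∃ T : k[X], T.natDegree ≤ M * (s.card * (m + 1)) ∧
      (∏ i ∈ s, (C (c i).2 * (f n).1.1 - C (c i).1 * (f n).1.2)) ^ M =
        wronskian (f n).1.1 (f n).1.2 * T := by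
    obtain ⟨T, hT⟩ := (hf n).wronskian_dvd
    refine ⟨T, ?_, hT⟩
    by_cases hT0 : T = 0
    · simp [hT0]
    have hW : wronskian (f n).1.1 (f n).1.2 ≠ 0 := fun h => (hf n).wronskian_coeff (by simp [h])
    refine le_trans ?_ (hZ n)
    rw [hT, natDegree_mul hW hT0]
    exact Nat.le_add_left _ _
  choose T' hTd' hT' using hT
  obtain ⟨T, -, hT⟩ := exists_forall_map_evalRingHom_eq T' hTd'
  have hdvd : (∏ i ∈ s, (C (fun _ => (c i).2) * P - C (fun _ => (c i).1) * Q)) ^ M =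
      wronskian P Q * T := ext_of_map_evalRingHom fun n => by
    simp only [Polynomial.map_pow, Polynomial.map_prod, Polynomial.map_sub, Polynomial.map_mul,
      map_C, ← wronskian_map, hP, hQ, hT, Pi.evalRingHom_apply, hT']
  have hcoeff (p : (ℕ → k)[X]) (i n : ℕ) : p.coeff i n = (p.map (ev n)).coeff i := by simp [ev]
  have heval (p : (ℕ → k)[X]) (x : ℕ → k) (n : ℕ) :
      p.eval x n = (p.map (ev n)).eval (x n) := by
    rw [eval_map]
    exact (eval₂_at_apply (ev n) x).symm
  have hγeval (p : (ℕ → k)[X]) (x : ℕ → k) : (p.map γ).eval (γ x) = γ (p.eval x) := by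
    rw [eval_map, eval₂_at_apply]
  have hQtop : Q.coeff (m + 1) = 1 := by
    ext n
    rw [hcoeff, hQ, ← (hf n).natDegree_eq, (hf n).monic.coeff_natDegree, Pi.one_apply]
  have hQtop' : (Q.map γ).coeff (m + 1) = 1 := by rw [coeff_map, hQtop, map_one]
  have hQdeg : (Q.map γ).natDegree = m + 1 :=
    le_antisymm (natDegree_map_le.trans hQd)
      (le_natDegree_of_ne_zero (by rw [hQtop']; exact one_ne_zero))
  have hnorm : IsNormalizedPair m M (fun i => algebraMap k (Germ (φ : Filter ℕ) k) (t i)) s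
      (fun i => (algebraMap k _ (c i).1, algebraMap k _ (c i).2)) (P.map γ) (Q.map γ) := by
    refine ⟨natDegree_map_le.trans hPd, ?_, ?_, hQdeg, ?_, ?_,
      ⟨A.map γ, B.map γ, ?_⟩, ?_, ?_, ?_, ⟨T.map γ, ?_⟩⟩
    · rw [coeff_map, hconst]
      exact congrArg γ (funext fun n => by rw [hcoeff, hP, (hf n).coeff_eq])
    · rw [Monic, leadingCoeff, hQdeg, hQtop']
    · rw [← map_zero γ, hγeval, hγeval, hconst, ← map_mul]
      exact congrArg γ (funext fun n => by
        rw [Pi.mul_apply, heval, heval, hP, hQ]; exact (hf n).eval_zero)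
    · rw [← map_one γ, hγeval, hγeval, hconst, ← map_mul]
      exact congrArg γ (funext fun n => by
        rw [Pi.mul_apply, heval, heval, hP, hQ]; exact (hf n).eval_one)
    · simpa using congrArg (Polynomial.map γ) hAB
    · rw [wronskian_map, ← map_zero γ, hγeval, map_zero]
      exact γ_ne fun n => by
        rw [heval, ← wronskian_map, hP, hQ]; exact (hf n).wronskian_eval_zero
    · rw [wronskian_map, ← map_one γ, hγeval]
      exact γ_ne fun n => by
        rw [heval, ← wronskian_map, hP, hQ]; exact (hf n).wronskian_eval_one
    · rw [wronskian_map, coeff_map]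
      exact γ_ne fun n => by
        rw [hcoeff, ← wronskian_map, hP, hQ]; exact (hf n).wronskian_coeff
    · simpa [Polynomial.map_prod, wronskian_map, hconst] using congrArg (Polynomial.map γ) hdvd
  choose a ha using fun i => RingHom.mem_range.1 (hnorm.coeff_mem_range hc i).1
  choose b hb using fun i => RingHom.mem_range.1 (hnorm.coeff_mem_range hc i).2
  have hPa : ∀ᶠ n in φ, ∀ i ∈ Finset.range (m + 2),
      (f n).1.1.coeff i = a i ∧ (f n).1.2.coeff i = b i := by
    rw [Filter.eventually_all_finset]
    intro i _
    have h1 := ha i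
    have h2 := hb i
    rw [coeff_map, hconst, eq_comm, γ_eq] at h1 h2
    filter_upwards [h1, h2] with n h1 h2
    rw [hcoeff, hP] at h1
    rw [hcoeff, hQ] at h2
    exact ⟨h1, h2⟩
  refine notMem_hyperfilter_of_finite (Set.Subsingleton.finite fun n hn n' hn' => ?_) hPa
  refine f.injective (Subtype.ext (Prod.ext ?_ ?_)) <;> ext i
  all_goals
    rcases lt_or_ge i (m + 2) with hi | hi
    · have h := hn i (Finset.mem_range.2 hi)
      have h' := hn' i (Finset.mem_range.2 hi)
      first | exact h.1.trans h'.1.symm | exact h.2.trans h'.2.symm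
    · have h1 := (hf n).natDegree_le
      have h2 := (hf n).natDegree_eq
      have h3 := (hf n').natDegree_le
      have h4 := (hf n').natDegree_eq
      rw [coeff_eq_zero_of_natDegree_lt (by omega), coeff_eq_zero_of_natDegree_lt (by omega)]

open Classical in
theorem Polynomial.dvd_pow_of_forall_isRoot {K : Type*} [Field K] [IsAlgClosed K] {W Z : K[X]}
    {N : ℕ} (hW : W ≠ 0) (h : ∀ z, W.IsRoot z → Z.IsRoot z) (hN : N ≠ 0)
    (hd : W.natDegree ≤ N) : W ∣ Z ^ N := by
  rcases eq_or_ne Z 0 with rfl | hZ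
  · simp [hN]
  refine (IsAlgClosed.splits W).dvd_of_roots_le_roots hW (Multiset.le_iff_count.2 fun z => ?_)
  by_cases hz : W.IsRoot z
  · rw [roots_pow, Multiset.count_nsmul]
    have h1 : 1 ≤ Z.roots.count z := Multiset.one_le_count_iff_mem.2 ((mem_roots hZ).2 (h z hz))
    calc W.roots.count z ≤ W.roots.card := Multiset.count_le_card _ _
      _ ≤ N := (card_roots' W).trans hd
      _ ≤ N * Z.roots.count z := Nat.le_mul_of_pos_right _ h1
  · rw [Multiset.count_eq_zero.2 fun h => hz (isRoot_of_mem_roots h)]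
    exact Nat.zero_le _

theorem Polynomial.coeff_wronskian_of_coeff_eq {R : Type*} [CommRing R] {m : ℕ} {P Q : R[X]}
    {t : R} (hP : P.natDegree ≤ m + 1) (hQ : Q.natDegree ≤ m + 1)
    (h : P.coeff (m + 1) = t * Q.coeff (m + 1)) : (wronskian P Q).coeff (2 * m) =
      (P.coeff m - t * Q.coeff m) * Q.coeff (m + 1) := by
  set S := P - C t * Q with hS
  have hW : wronskian P Q = S * derivative Q - derivative S * Q := by
    simp only [wronskian, hS, derivative_sub, derivative_C_mul]
    ring
  have hdeg : S.natDegree ≤ m := natDegree_le_iff_coeff_eq_zero.2 fun N hN => by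
    rcases (Nat.succ_le_iff.2 hN).eq_or_lt with rfl | hN
    · simp [hS, h]
    · simp [hS, coeff_eq_zero_of_natDegree_lt (hP.trans_lt hN),
        coeff_eq_zero_of_natDegree_lt (hQ.trans_lt hN)]
  have hX : (X * derivative S).natDegree ≤ m := natDegree_le_iff_coeff_eq_zero.2 fun N hN => by
    obtain ⟨N, rfl⟩ := Nat.exists_eq_succ_of_ne_zero (Nat.ne_zero_of_lt hN)
    rw [coeff_X_mul, coeff_derivative, coeff_eq_zero_of_natDegree_lt (hdeg.trans_lt hN), zero_mul]
  have hX' : (X * derivative S).coeff m = m * S.coeff m := by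
    cases m with
    | zero => simp
    | succ m => rw [coeff_X_mul, coeff_derivative]; push_cast; ring
  have hQ' : (derivative Q).natDegree ≤ m := (natDegree_derivative_le Q).trans (by omega)
  rw [hW, coeff_sub, ← coeff_X_mul (derivative S * Q), ← mul_assoc,
    show 2 * m + 1 = m + (m + 1) by ring, coeff_mul_add_eq_of_natDegree_le hX hQ, two_mul,
    coeff_mul_add_eq_of_natDegree_le hdeg hQ', hX', coeff_derivative]
  simp only [hS, coeff_sub, coeff_C_mul]
  ring

end NormalizedPairs

section BinaryForms

open Polynomial

/-- The dehomogenization `x₀ = X`, `x₁ = 1` of a binary form. -/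
def formPoly {n : ℕ} (a : Coeffs n) : ℂ[X] := ∑ i : Fin (n + 1), C (a i) * X ^ (i : ℕ)

theorem coeff_formPoly {n : ℕ} (a : Coeffs n) (i : Fin (n + 1)) : (formPoly a).coeff i = a i := by
  simp only [formPoly, finsetSum_coeff, coeff_C_mul_X_pow]
  rw [Finset.sum_eq_single i] <;> simp +contextual [Fin.ext_iff, eq_comm]

theorem natDegree_formPoly_le {n : ℕ} (a : Coeffs n) : (formPoly a).natDegree ≤ n :=
  natDegree_sum_le_of_forall_le _ _ fun i _ =>
    (natDegree_C_mul_X_pow_le _ _).trans (Nat.lt_succ_iff.1 i.2)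

theorem formPoly_injective {n : ℕ} : Function.Injective (formPoly (n := n)) := fun a b h => by
  funext i
  rw [← coeff_formPoly a, h, coeff_formPoly]

theorem formPoly_smul_sub_smul {n : ℕ} (a b : Coeffs n) (s t : ℂ) :
    formPoly (s • a - t • b) = C s * formPoly a - C t * formPoly b := by
  simp only [formPoly, Finset.mul_sum, ← Finset.sum_sub_distrib]
  refine Finset.sum_congr rfl fun i _ => ?_
  simp only [Pi.sub_apply, Pi.smul_apply, smul_eq_mul, map_sub, map_mul]
  ring

theorem evalForm_smul_sub_smul {n : ℕ} (a b : Coeffs n) (s t : ℂ) (x : Fin 2 → ℂ) :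
    evalForm (s • a - t • b) x = s * evalForm a x - t * evalForm b x := by
  simp only [evalForm, Finset.mul_sum, ← Finset.sum_sub_distrib]
  refine Finset.sum_congr rfl fun i _ => ?_
  simp only [Pi.sub_apply, Pi.smul_apply, smul_eq_mul]
  ring

theorem evalForm_smul {n : ℕ} (a : Coeffs n) (s : ℂ) (x : Fin 2 → ℂ) :
    evalForm a (s • x) = s ^ n * evalForm a x := by
  simp only [evalForm, Finset.mul_sum]
  refine Finset.sum_congr rfl fun i _ => ?_
  have h : s ^ n = s ^ (i : ℕ) * s ^ (n - (i : ℕ)) := by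
    rw [← pow_add, Nat.add_sub_cancel' (Nat.lt_succ_iff.1 i.2)]
  simp only [Pi.smul_apply, smul_eq_mul, h, mul_pow]
  ring

theorem evalForm_affine {n : ℕ} (a : Coeffs n) (z : ℂ) :
    evalForm a ![z, 1] = (formPoly a).eval z := by
  simp [evalForm, formPoly, eval_finsetSum]

theorem evalForm_infty {n : ℕ} (a : Coeffs n) : evalForm a ![1, 0] = (formPoly a).coeff n := by
  have h := coeff_formPoly a (Fin.last n)
  rw [Fin.val_last] at h
  rw [h, evalForm, Finset.sum_eq_single (Fin.last n)]
  · simp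
  · intro i _ hi
    have : (i : ℕ) < n := Fin.lt_last_iff_ne_last.2 hi
    simp [zero_pow (Nat.sub_ne_zero_of_lt this)]
  · simp

theorem affine_ne_zero (z : ℂ) : (![z, 1] : Fin 2 → ℂ) ≠ 0 := fun h => by
  simpa using congrFun h 1

theorem infty_ne_zero : (![1, 0] : Fin 2 → ℂ) ≠ 0 := fun h => by
  simpa using congrFun h 0

/-- Every point of the projective line is at infinity or affine, up to scaling. -/
theorem eq_smul_infty_or_affine (x : Fin 2 → ℂ) (hx : x ≠ 0) :
    ∃ s : ℂ, s ≠ 0 ∧ (x = s • ![1, 0] ∨ ∃ z, x = s • ![z, 1]) := by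
  by_cases h : x 1 = 0
  · refine ⟨x 0, fun h0 => hx ?_, Or.inl ?_⟩
    · funext i; fin_cases i <;> simp [h, h0]
    · funext i; fin_cases i <;> simp [h]
  · refine ⟨x 1, h, Or.inr ⟨x 0 / x 1, ?_⟩⟩
    funext i; fin_cases i
    · simp [mul_div_cancel₀ _ h]
    · simp

theorem exists_evalForm_eq_zero {n : ℕ} (hn : 1 ≤ n) (a : Coeffs n) :
    ∃ x : Fin 2 → ℂ, x ≠ 0 ∧ evalForm a x = 0 := by
  by_cases h : (formPoly a).coeff n = 0
  · exact ⟨_, infty_ne_zero, by rw [evalForm_infty, h]⟩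
  · have hd : (formPoly a).degree ≠ 0 := fun h0 => by
      have h1 := le_natDegree_of_ne_zero h
      rw [natDegree_eq_of_degree_eq_some h0] at h1
      exact absurd (hn.trans h1) (by decide)
    obtain ⟨z, hz⟩ := IsAlgClosed.exists_root _ hd
    exact ⟨_, affine_ne_zero z, by rw [evalForm_affine]; exact hz⟩

/-- The zero set of a binary form on the projective line. -/
def zeroSet {n : ℕ} (r : Coeffs n) : Set (Projectivization ℂ (Fin 2 → ℂ)) :=
  {x | evalForm r x.rep = 0}

theorem mk_mem_zeroSet {n : ℕ} (r : Coeffs n) (v : Fin 2 → ℂ) (hv : v ≠ 0) :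
    Projectivization.mk ℂ v hv ∈ zeroSet r ↔ evalForm r v = 0 := by
  obtain ⟨s, hs⟩ := Projectivization.exists_smul_eq_mk_rep ℂ v hv
  rw [zeroSet, Set.mem_ofPred_eq, ← hs, Units.smul_def, evalForm_smul]
  simp

theorem fiberSet_eq_zeroSet {n : ℕ} (a b : Coeffs n) (c : Projectivization ℂ (Fin 2 → ℂ)) :
    fiberSet a b c = zeroSet (c.rep 1 • a - c.rep 0 • b) := by
  ext x
  simp only [fiberSet, zeroSet, Set.mem_ofPred_eq, evalForm_smul_sub_smul]

/-- The point `[z : 1]` of the projective line. -/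
def affinePoint (z : ℂ) : Projectivization ℂ (Fin 2 → ℂ) := .mk ℂ _ (affine_ne_zero z)

/-- The point `[1 : 0]` of the projective line. -/
def inftyPoint : Projectivization ℂ (Fin 2 → ℂ) := .mk ℂ _ infty_ne_zero

theorem affinePoint_injective : Function.Injective affinePoint := fun z w h => by
  obtain ⟨s, hs⟩ := (Projectivization.mk_eq_mk_iff' ℂ _ _ _ _).1 h
  have h0 := congrFun hs 0
  have h1 := congrFun hs 1
  simp at h0 h1
  simpa [h1] using h0.symm

theorem zeroSet_subset {n : ℕ} (r : Coeffs n) (hr : formPoly r ≠ 0) :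
    zeroSet r ⊆ affinePoint '' ↑(formPoly r).roots.toFinset ∪
      {x | x = inftyPoint ∧ (formPoly r).coeff n = 0} := by
  intro x hx
  induction x using Projectivization.ind with | _ v hv =>
  rw [mk_mem_zeroSet] at hx
  obtain ⟨s, hs, rfl | ⟨z, rfl⟩⟩ := eq_smul_infty_or_affine v hv
  · right
    refine ⟨(Projectivization.mk_eq_mk_iff' ..).2 ⟨s, rfl⟩, ?_⟩
    rw [evalForm_smul, evalForm_infty] at hx
    exact (mul_eq_zero_iff_left (pow_ne_zero _ hs)).1 hx
  · left
    refine ⟨z, ?_, ((Projectivization.mk_eq_mk_iff' ..).2 ⟨s, rfl⟩).symm⟩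
    rw [evalForm_smul, evalForm_affine] at hx
    simpa [hs, hr] using hx

theorem finite_zeroSet {n : ℕ} (r : Coeffs n) (hr : formPoly r ≠ 0) : (zeroSet r).Finite :=
  (((Finset.finite_toSet _).image _).union
    ((Set.finite_singleton inftyPoint).subset fun _ h => h.1)).subset (zeroSet_subset r hr)

theorem ncard_zeroSet_le {n : ℕ} (r : Coeffs n) (hr : formPoly r ≠ 0) :
    (zeroSet r).ncard ≤
      (formPoly r).roots.toFinset.card + if (formPoly r).coeff n = 0 then 1 else 0 := by
  refine (Set.ncard_le_ncard (zeroSet_subset r hr) (((Finset.finite_toSet _).image _).union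
    ((Set.finite_singleton inftyPoint).subset fun _ h => h.1))).trans
    ((Set.ncard_union_le _ _).trans (add_le_add ?_ ?_))
  · exact (Set.ncard_image_le (Finset.finite_toSet _)).trans (Set.ncard_coe_finset _).le
  · split_ifs with h <;> simp [h]

/-- A multiple affine zero reduces the number of zeros. -/
theorem ncard_zeroSet_lt_of_isRoot {n : ℕ} (r : Coeffs n) (hr : formPoly r ≠ 0) {z : ℂ}
    (h : (formPoly r).eval z = 0) (h' : (derivative (formPoly r)).eval z = 0) :
    (zeroSet r).ncard < n := by
  refine (ncard_zeroSet_le r hr).trans_lt ?_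
  have h1 : (formPoly r).roots.toFinset.card < (formPoly r).roots.card := by
    refine lt_of_le_of_ne (Multiset.toFinset_card_le _) fun he => ?_
    have h2 := (one_lt_rootMultiplicity_iff_isRoot hr).2 ⟨h, h'⟩
    rw [← count_roots] at h2
    exact h2.not_ge (Multiset.nodup_iff_count_le_one.1 (Multiset.toFinset_card_eq_card_iff_nodup.1 he) z)
  have h3 := card_roots' (formPoly r)
  have h4 := natDegree_formPoly_le r
  split_ifs with h5
  · have : (formPoly r).natDegree ≠ n := fun h6 => hr <| leadingCoeff_eq_zero.1 <| by
      rw [leadingCoeff, h6, h5]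
    omega
  · omega

/-- A multiple zero at infinity reduces the number of zeros. -/
theorem ncard_zeroSet_lt_of_coeff {m : ℕ} (r : Coeffs (m + 1)) (hr : formPoly r ≠ 0)
    (h : (formPoly r).coeff (m + 1) = 0) (h' : (formPoly r).coeff m = 0) :
    (zeroSet r).ncard < m + 1 := by
  refine (ncard_zeroSet_le r hr).trans_lt ?_
  rw [if_pos h]
  have h1 := Multiset.toFinset_card_le (formPoly r).roots
  have h3 := card_roots' (formPoly r)
  have h4 := natDegree_formPoly_le r
  have h5 : (formPoly r).natDegree ≠ m + 1 := fun h6 => hr <| leadingCoeff_eq_zero.1 <| by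
      rw [leadingCoeff, h6, h]
  have h7 : (formPoly r).natDegree ≠ m := fun h6 => hr <| leadingCoeff_eq_zero.1 <| by
      rw [leadingCoeff, h6, h']
  omega

theorem le_ncard_zeroSet {n : ℕ} (r : Coeffs n) (hr : (formPoly r).coeff n ≠ 0)
    (h : ∀ z, (formPoly r).eval z = 0 → (derivative (formPoly r)).eval z ≠ 0) :
    n ≤ (zeroSet r).ncard := by
  have h0 : formPoly r ≠ 0 := fun h => hr (by simp [h])
  have h1 : (formPoly r).roots.Nodup := Multiset.nodup_iff_count_le_one.2 fun z => by
    by_contra! h2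
    rw [count_roots, one_lt_rootMultiplicity_iff_isRoot h0] at h2
    exact h z h2.1 h2.2
  calc n ≤ (formPoly r).natDegree := le_natDegree_of_ne_zero hr
    _ = (formPoly r).roots.card := (IsAlgClosed.splits _).natDegree_eq_card_roots
    _ = (formPoly r).roots.toFinset.card := (Multiset.toFinset_card_of_nodup h1).symm
    _ = (affinePoint '' ↑(formPoly r).roots.toFinset).ncard := by
      rw [Set.ncard_image_of_injective _ affinePoint_injective, Set.ncard_coe_finset]
    _ ≤ _ := Set.ncard_le_ncard (by
      rintro _ ⟨z, hz, rfl⟩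
      rw [affinePoint, mk_mem_zeroSet, evalForm_affine]
      simpa [h0] using hz) (finite_zeroSet r h0)

theorem exists_rep_mk_eq_smul (v : Fin 2 → ℂ) (hv : v ≠ 0) :
    ∃ s : ℂ, s ≠ 0 ∧ (Projectivization.mk ℂ v hv).rep = s • v := by
  obtain ⟨s, hs⟩ := Projectivization.exists_smul_eq_mk_rep ℂ v hv
  exact ⟨s, s.ne_zero, hs.symm⟩

theorem eq_mk_of_rep_mul_eq (c : Projectivization ℂ (Fin 2 → ℂ)) (v : Fin 2 → ℂ) (hv : v ≠ 0)
    (h : c.rep 1 * v 0 = c.rep 0 * v 1) : c = .mk ℂ v hv := by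
  rw [← c.mk_rep, Projectivization.mk_eq_mk_iff']
  by_cases h0 : v 0 = 0
  · have h1 : v 1 ≠ 0 := fun h1 => hv (by funext i; fin_cases i <;> simp [h0, h1])
    refine ⟨c.rep 1 / v 1, ?_⟩
    funext i; fin_cases i
    · simp only [h0, mul_zero, zero_eq_mul, h1, or_false] at h
      simp [h0, h]
    · simp [h1]
  · refine ⟨c.rep 0 / v 0, ?_⟩
    funext i; fin_cases i
    · simp [h0]
    · simp only [Fin.mk_one, Pi.smul_apply, smul_eq_mul]
      rw [div_mul_eq_mul_div, ← h, mul_div_cancel_right₀ _ h0]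

theorem subsingleton_rep_mul_eq (v : Fin 2 → ℂ) (hv : v ≠ 0) :
    {c : Projectivization ℂ (Fin 2 → ℂ) | c.rep 1 * v 0 = c.rep 0 * v 1}.Subsingleton :=
  fun c hc d hd => (eq_mk_of_rep_mul_eq c v hv hc).trans (eq_mk_of_rep_mul_eq d v hv hd).symm

theorem rep_one_ne_zero_or (c : Projectivization ℂ (Fin 2 → ℂ)) : c.rep 1 ≠ 0 ∨ c.rep 0 ≠ 0 := by
  by_contra! h
  exact c.rep_nonzero (by funext i; fin_cases i <;> simp [h])

section Pencil

variable {m : ℕ} {a b : Coeffs (m + 1)}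

theorem IsCoprimePair.formPoly_pencil_ne_zero (hab : IsCoprimePair a b) {s t : ℂ}
    (h : s ≠ 0 ∨ t ≠ 0) : formPoly (s • a - t • b) ≠ 0 := fun h0 => by
  have h1 : s • a - t • b = 0 := formPoly_injective (h0.trans (by simp [formPoly]))
  have h2 (x : Fin 2 → ℂ) : s * evalForm a x - t * evalForm b x = 0 := by
    rw [← evalForm_smul_sub_smul, h1]; simp [evalForm]
  rcases h with h | h
  · obtain ⟨x, hx, hb⟩ := exists_evalForm_eq_zero m.succ_pos b
    have := h2 x
    simp only [hb, mul_zero, sub_zero, mul_eq_zero, h, false_or] at this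
    exact (hab x hx).elim (· this) (· hb)
  · obtain ⟨x, hx, ha⟩ := exists_evalForm_eq_zero m.succ_pos a
    have := h2 x
    simp only [ha, mul_zero, zero_sub, neg_eq_zero, mul_eq_zero, h, false_or] at this
    exact (hab x hx).elim (· ha) (· this)

theorem IsCoprimePair.value_ne_zero (hab : IsCoprimePair a b) {x : Fin 2 → ℂ} (hx : x ≠ 0) :
    (![evalForm a x, evalForm b x] : Fin 2 → ℂ) ≠ 0 := fun h =>
  (hab x hx).elim (· (by simpa using congrFun h 0)) (· (by simpa using congrFun h 1))

theorem IsCoprimePair.isCoprime_formPoly (hab : IsCoprimePair a b) :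
    IsCoprime (formPoly a) (formPoly b) := by
  rw [isCoprime_iff_aeval_ne_zero_of_isAlgClosed ℂ ℂ]
  intro z
  simpa [evalForm_affine] using hab _ (affine_ne_zero z)

theorem IsCoprimePair.wronskian_ne_zero (hab : IsCoprimePair a b) :
    wronskian (formPoly a) (formPoly b) ≠ 0 := fun h => by
  obtain ⟨ha, hb⟩ := hab.isCoprime_formPoly.wronskian_eq_zero_iff.1 h
  have ha := derivative_eq_zero.1 ha
  have hb := derivative_eq_zero.1 hb
  refine (hab _ infty_ne_zero).elim (· ?_) (· ?_) <;>
    rw [evalForm_infty, coeff_eq_zero_of_natDegree_lt (by omega)]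

theorem defect_ne_zero_iff (c : Projectivization ℂ (Fin 2 → ℂ)) : defect a b c ≠ 0 ↔
      (zeroSet (c.rep 1 • a - c.rep 0 • b)).ncard < m + 1 := by
  rw [defect, fiberSet_eq_zeroSet]
  omega

theorem IsCoprimePair.defect_ne_zero_of_wronskian (hab : IsCoprimePair a b) {z : ℂ}
    (hz : (wronskian (formPoly a) (formPoly b)).eval z = 0) (c : Projectivization ℂ (Fin 2 → ℂ))
    (hc : c.rep 1 * (formPoly a).eval z = c.rep 0 * (formPoly b).eval z) :
    defect a b c ≠ 0 := by
  rw [defect_ne_zero_iff]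
  have hv := hab.value_ne_zero (affine_ne_zero z)
  refine ncard_zeroSet_lt_of_isRoot _ (hab.formPoly_pencil_ne_zero (rep_one_ne_zero_or c))
    (z := z) ?_ ?_
  · simp [formPoly_smul_sub_smul, hc]
  · obtain ⟨s, -, hs⟩ := exists_rep_mk_eq_smul _ hv
    rw [eq_mk_of_rep_mul_eq c _ hv (by simpa [evalForm_affine] using hc), hs]
    simp only [wronskian, eval_sub, eval_mul] at hz
    simp [formPoly_smul_sub_smul, evalForm_affine]
    linear_combination -s * hz

theorem exists_wronskian_eq_zero_of_defect_ne_zero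
    {c : Projectivization ℂ (Fin 2 → ℂ)} (hc : defect a b c ≠ 0) :
    c.rep 1 * evalForm a ![1, 0] = c.rep 0 * evalForm b ![1, 0] ∨
      ∃ z, (wronskian (formPoly a) (formPoly b)).eval z = 0 ∧
        c.rep 1 * evalForm a ![z, 1] = c.rep 0 * evalForm b ![z, 1] := by
  rw [defect_ne_zero_iff] at hc
  by_contra! h
  refine hc.not_ge (le_ncard_zeroSet _ ?_ fun z hz hz' => h.2 z ?_ ?_)
  · simpa [formPoly_smul_sub_smul, evalForm_infty, sub_eq_zero] using h.1
  · simp only [formPoly_smul_sub_smul, eval_sub, eval_mul, eval_C, derivative_sub,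
      derivative_mul, derivative_C, zero_mul, zero_add] at hz hz'
    simp only [wronskian, eval_sub, eval_mul]
    rcases rep_one_ne_zero_or c with h | h <;> refine mul_left_cancel₀ h ?_
    · linear_combination (derivative (formPoly b)).eval z * hz - (formPoly b).eval z * hz'
    · linear_combination (derivative (formPoly a)).eval z * hz - (formPoly a).eval z * hz'
  · simpa [formPoly_smul_sub_smul, evalForm_affine, sub_eq_zero] using hz

/-- A rational function has finitely many critical values. -/
theorem IsCoprimePair.finite_defect_ne_zero (hab : IsCoprimePair a b) :
    {c | defect a b c ≠ 0}.Finite := by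
  have key (x : Fin 2 → ℂ) (hx : x ≠ 0) : {c : Projectivization ℂ (Fin 2 → ℂ) |
      c.rep 1 * evalForm a x = c.rep 0 * evalForm b x}.Finite := by
    simpa using (subsingleton_rep_mul_eq _ (hab.value_ne_zero hx)).finite
  refine ((key _ infty_ne_zero).union
    ((wronskian (formPoly a) (formPoly b)).roots.toFinset.finite_toSet.biUnion
      fun z _ => key _ (affine_ne_zero z))).subset fun c hc => ?_
  refine (exists_wronskian_eq_zero_of_defect_ne_zero hc).imp id ?_
  rintro ⟨z, hz, h⟩
  exact Set.mem_biUnion (by simpa [hab.wronskian_ne_zero] using hz) h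

theorem IsCoprimePair.isNormalizedPair (hab : IsCoprimePair a b) {t : Fin 3 → ℂ}
    (ht : ∀ i, defect a b (affinePoint (t i)) = 0)
    (h₀ : evalForm a ![1, 0] = t 0 * evalForm b ![1, 0])
    (h₁ : evalForm a ![0, 1] = t 1 * evalForm b ![0, 1])
    (h₂ : evalForm a ![1, 1] = t 2 * evalForm b ![1, 1]) (hb : evalForm b ![1, 0] = 1)
    (s : Finset (Projectivization ℂ (Fin 2 → ℂ))) (hs : ∀ c, defect a b c ≠ 0 → c ∈ s) :
    IsNormalizedPair m (2 * (m + 1)) t s (fun c => (c.rep 0, c.rep 1))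
      (formPoly a) (formPoly b) := by
  have hrep (i : Fin 3) (x y : ℂ) (h : x = t i * y) :
      (affinePoint (t i)).rep 1 * x = (affinePoint (t i)).rep 0 * y := by
    obtain ⟨r, -, hr⟩ := exists_rep_mk_eq_smul _ (affine_ne_zero (t i))
    rw [affinePoint, hr, h]
    simp only [Pi.smul_apply, Matrix.cons_val_zero, Matrix.cons_val_one, smul_eq_mul]
    ring
  have hb0 := natDegree_formPoly_le b
  have hbc : (formPoly b).coeff (m + 1) = 1 := by rwa [← evalForm_infty]
  rw [evalForm_affine, evalForm_affine] at h₁ h₂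
  rw [evalForm_infty, evalForm_infty, hbc, mul_one] at h₀
  have hbd : (formPoly b).natDegree = m + 1 :=
    hb0.antisymm (le_natDegree_of_ne_zero (by rw [hbc]; exact one_ne_zero))
  refine ⟨natDegree_formPoly_le a, h₀, by rw [Monic, leadingCoeff, hbd, hbc], hbd, h₁, h₂,
    hab.isCoprime_formPoly, fun h => hab.defect_ne_zero_of_wronskian h _ (hrep 1 _ _ h₁) (ht 1),
    fun h => hab.defect_ne_zero_of_wronskian h _ (hrep 2 _ _ h₂) (ht 2), fun h => ?_, ?_⟩
  · refine (defect_ne_zero_iff (affinePoint (t 0))).2 (ncard_zeroSet_lt_of_coeff _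
      (hab.formPoly_pencil_ne_zero (rep_one_ne_zero_or _)) ?_ ?_) (ht 0)
    · simp only [formPoly_smul_sub_smul, coeff_sub, coeff_C_mul]
      exact sub_eq_zero.2 (hrep 0 _ _ (by rw [h₀, hbc, mul_one]))
    · simp only [formPoly_smul_sub_smul, coeff_sub, coeff_C_mul]
      refine sub_eq_zero.2 (hrep 0 _ _ ?_)
      rwa [coeff_wronskian_of_coeff_eq (natDegree_formPoly_le a) hb0 (t := t 0)
        (by rw [h₀, hbc, mul_one]), hbc, mul_one, sub_eq_zero] at h
  · refine dvd_pow_of_forall_isRoot hab.wronskian_ne_zero (fun z hz => ?_) (by omega) ?_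
    · have hv := hab.value_ne_zero (affine_ne_zero z)
      rw [IsRoot.def, eval_prod]
      obtain ⟨r, -, hr⟩ := exists_rep_mk_eq_smul _ hv
      have hr' : (Projectivization.mk ℂ _ hv).rep 1 * (formPoly a).eval z =
          (Projectivization.mk ℂ _ hv).rep 0 * (formPoly b).eval z := by
        rw [hr]
        simp only [evalForm_affine, Pi.smul_apply, Matrix.cons_val_zero, Matrix.cons_val_one,
          smul_eq_mul]
        ring
      refine Finset.prod_eq_zero (hs _ (hab.defect_ne_zero_of_wronskian hz _ hr')) ?_
      simpa [sub_eq_zero] using hr'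
    · have := natDegree_wronskian_lt_add hab.wronskian_ne_zero
      have := natDegree_formPoly_le a
      omega

end Pencil

theorem evalForm_eq_eval_toPoly {n : ℕ} (a : Coeffs n) (x : Fin 2 → ℂ) :
    evalForm a x = MvPolynomial.eval x (toPoly a) := by
  simp [evalForm, toPoly]

theorem isHomogeneous_toPoly {n : ℕ} (a : Coeffs n) : (toPoly a).IsHomogeneous n := by
  refine MvPolynomial.IsHomogeneous.sum _ _ _ fun i _ => ?_
  have h := ((MvPolynomial.isHomogeneous_C (Fin 2) (a i)).mul
    ((MvPolynomial.isHomogeneous_X ℂ (0 : Fin 2)).pow i)).mul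
    ((MvPolynomial.isHomogeneous_X ℂ (1 : Fin 2)).pow (n - i))
  rwa [zero_add, one_mul, one_mul, Nat.add_sub_cancel' (Nat.lt_succ_iff.1 i.2)] at h

theorem evalForm_ofPoly {n : ℕ} {p : MvPolynomial (Fin 2) ℂ} (hp : p.IsHomogeneous n)
    (x : Fin 2 → ℂ) : evalForm (ofPoly n p) x = MvPolynomial.eval x p := by
  set e : Fin (n + 1) → Fin 2 →₀ ℕ := fun j =>
    Finsupp.single 0 (j : ℕ) + Finsupp.single 1 (n - (j : ℕ)) with he
  have hinj : Function.Injective e := fun i j h => by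
    simpa [he, Fin.ext_iff] using DFunLike.congr_fun h 0
  rw [MvPolynomial.eval_eq', Finset.sum_subset (s₂ := Finset.univ.image e), Finset.sum_image
    hinj.injOn]
  · refine Finset.sum_congr rfl fun j _ => ?_
    simp [ofPoly, he, Fin.prod_univ_two, mul_assoc]
  · intro d hd
    have hdn := hp (MvPolynomial.mem_support_iff.1 hd)
    rw [Finsupp.weight_apply, Finsupp.sum_fintype _ _ (by simp), Fin.sum_univ_two] at hdn
    simp only [Pi.one_apply, smul_eq_mul, mul_one] at hdn
    refine Finset.mem_image.2 ⟨⟨d 0, by omega⟩, Finset.mem_univ _, ?_⟩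
    ext i; fin_cases i
    · simp [he]
    · simp [he]; omega
  · intro d _ hd
    rw [MvPolynomial.notMem_support_iff.1 hd, zero_mul]

theorem evalForm_compForm {n : ℕ} (a : Coeffs n) (g : Matrix (Fin 2) (Fin 2) ℂ)
    (x : Fin 2 → ℂ) : evalForm (compForm a g) x = evalForm a (Matrix.vecMul x g) := by
  have hl (j : Fin 2) : (∑ i : Fin 2, MvPolynomial.C (g i j) * MvPolynomial.X i).IsHomogeneous 1 :=
    MvPolynomial.IsHomogeneous.sum _ _ _ fun i _ => by
      simpa using (MvPolynomial.isHomogeneous_C (Fin 2) (g i j)).mul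
        (MvPolynomial.isHomogeneous_X ℂ i)
  have h := (isHomogeneous_toPoly a).aeval _ hl
  rw [one_mul] at h
  refine (evalForm_ofPoly h x).trans ?_
  rw [evalForm_eq_eval_toPoly, ← MvPolynomial.coe_aeval_eq_eval,
    ← MvPolynomial.coe_aeval_eq_eval, RingHom.coe_coe, RingHom.coe_coe,
    MvPolynomial.comp_aeval_apply]
  congr 2
  funext j
  simp [Matrix.vecMul, dotProduct, mul_comm]

section Substitution

open Matrix

theorem ncard_zeroSet_of_evalForm_eq {n : ℕ} {r r' : Coeffs n} {s : ℂ} (hs : s ≠ 0)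
    (g : GL (Fin 2) ℂ) (h : ∀ x, evalForm r' x = s * evalForm r (x ᵥ* g.val)) :
    (zeroSet r').ncard = (zeroSet r).ncard := by
  have hinj : Function.Injective (vecMulLinear g.val) := vecMul_injective_of_isUnit g.isUnit
  have hpre : zeroSet r' = Projectivization.map _ hinj ⁻¹' zeroSet r := by
    ext x
    induction x using Projectivization.ind with | _ v hv =>
    rw [Set.mem_preimage, Projectivization.map_mk, mk_mem_zeroSet, mk_mem_zeroSet, h]
    simp [hs]
  rw [hpre, Set.ncard_preimage_of_injective_subset_range (Projectivization.map_injective _ hinj)]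
  intro x _
  induction x using Projectivization.ind with | _ v hv =>
  have hmul : vecMulLinear g.val (v ᵥ* g⁻¹.val) = v := by
    rw [vecMulLinear_apply, vecMul_vecMul, ← Units.val_mul, inv_mul_cancel, Units.val_one,
      vecMul_one]
  refine ⟨.mk ℂ (v ᵥ* g⁻¹.val) fun h0 => hv ?_, ?_⟩
  · rw [← hmul, h0, map_zero]
  · simp only [Projectivization.map_mk, hmul]

theorem defect_eq_of_evalForm_eq {n : ℕ} {a b a' b' : Coeffs n} {s : ℂ} (hs : s ≠ 0)
    (g : GL (Fin 2) ℂ) (ha : ∀ x, evalForm a' x = s * evalForm a (x ᵥ* g.val))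
    (hb : ∀ x, evalForm b' x = s * evalForm b (x ᵥ* g.val))
    (c : Projectivization ℂ (Fin 2 → ℂ)) : defect a' b' c = defect a b c := by
  rw [defect, defect, fiberSet_eq_zeroSet, fiberSet_eq_zeroSet,
    ncard_zeroSet_of_evalForm_eq hs g fun x => ?_]
  rw [evalForm_smul_sub_smul, evalForm_smul_sub_smul, ha, hb]
  ring

theorem IsCoprimePair.of_evalForm_eq {n : ℕ} {a b a' b' : Coeffs n} (hab : IsCoprimePair a b)
    {s : ℂ} (hs : s ≠ 0) (g : GL (Fin 2) ℂ)
    (ha : ∀ x, evalForm a' x = s * evalForm a (x ᵥ* g.val))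
    (hb : ∀ x, evalForm b' x = s * evalForm b (x ᵥ* g.val)) : IsCoprimePair a' b' := fun x hx => by
  rw [ha, hb]
  have hinj : Function.Injective (vecMulLinear g.val) := vecMul_injective_of_isUnit g.isUnit
  exact (hab _ ((map_ne_zero_iff _ hinj).2 hx)).imp (mul_ne_zero hs) (mul_ne_zero hs)

theorem exists_GL_pr_eq {n : ℕ} (u : RatRep n) (g : GL (Fin 2) ℂ) {s : ℂ} (hs : s ≠ 0) :
    ∃ v : RatRep n, pr n (Quot.mk _ v) = pr n (Quot.mk _ u) ∧
      (∀ x, evalForm v.val.1 x = s * evalForm u.val.1 (x ᵥ* g.val)) ∧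
      (∀ x, evalForm v.val.2 x = s * evalForm u.val.2 (x ᵥ* g.val)) := by
  have hsmul (a : Coeffs n) (x) : evalForm (s • a) x = s * evalForm a x := by
    simpa using evalForm_smul_sub_smul a 0 s 0 x
  let w : RatRep n := ⟨(compForm u.val.1 g.val, compForm u.val.2 g.val),
    u.2.of_evalForm_eq one_ne_zero g (fun x => by rw [evalForm_compForm, one_mul])
      fun x => by rw [evalForm_compForm, one_mul]⟩
  have h1 x : evalForm (s • w.val.1) x = s * evalForm u.val.1 (x ᵥ* g.val) := by
    rw [hsmul, evalForm_compForm]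
  have h2 x : evalForm (s • w.val.2) x = s * evalForm u.val.2 (x ᵥ* g.val) := by
    rw [hsmul, evalForm_compForm]
  let v : RatRep n := ⟨(s • w.val.1, s • w.val.2), u.2.of_evalForm_eq hs g h1 h2⟩
  refine ⟨v, ?_, h1, h2⟩
  have hwv : Quot.mk (scaleRel n) w = Quot.mk _ v := Quot.sound ⟨Units.mk0 s hs, rfl⟩
  rw [← hwv]
  exact (Quot.sound ⟨u, w, g, rfl, rfl, rfl⟩).symm

/-- Three points of the projective line with distinct affine values can be moved to
`[1 : 0]`, `[0 : 1]` and `[1 : 1]`. -/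
theorem exists_normalized {m : ℕ} (u : RatRep (m + 1)) {t : Fin 3 → ℂ}
    (ht : Function.Injective t) :
    ∃ v : RatRep (m + 1), pr _ (Quot.mk _ v) = pr _ (Quot.mk _ u) ∧
      (∀ c, defect v.val.1 v.val.2 c = defect u.val.1 u.val.2 c) ∧
      evalForm v.val.1 ![1, 0] = t 0 * evalForm v.val.2 ![1, 0] ∧
      evalForm v.val.1 ![0, 1] = t 1 * evalForm v.val.2 ![0, 1] ∧
      evalForm v.val.1 ![1, 1] = t 2 * evalForm v.val.2 ![1, 1] ∧
      evalForm v.val.2 ![1, 0] = 1 := by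
  obtain ⟨⟨a, b⟩, hab⟩ := u
  have hx (i : Fin 3) : ∃ x : Fin 2 → ℂ, x ≠ 0 ∧ evalForm a x = t i * evalForm b x := by
    obtain ⟨x, hx, h⟩ := exists_evalForm_eq_zero m.succ_pos ((1 : ℂ) • a - t i • b)
    rw [evalForm_smul_sub_smul, one_mul, sub_eq_zero] at h
    exact ⟨x, hx, h⟩
  choose x hx0 hx using hx
  have hbx (i) : evalForm b (x i) ≠ 0 := fun h =>
    (hab _ (hx0 i)).elim (· (by rw [hx, h, mul_zero])) (· h)
  set D : Fin 3 → Fin 3 → ℂ := fun i j => x i 0 * x j 1 - x i 1 * x j 0 with hD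
  have hDne {i j : Fin 3} (hij : i ≠ j) : D i j ≠ 0 := fun h => by
    obtain ⟨s, hs⟩ : ∃ s : ℂ, s • x i = x j := by
      by_cases h0 : x i 0 = 0
      · have h1 : x i 1 ≠ 0 := fun h1 => hx0 i (by funext k; fin_cases k <;> simp [h0, h1])
        have h2 : x j 0 = 0 := by simpa [hD, h0, h1] using h
        refine ⟨x j 1 / x i 1, ?_⟩
        funext k; fin_cases k <;> simp [h0, h1, h2]
      · refine ⟨x j 0 / x i 0, ?_⟩
        funext k; fin_cases k
        · simp [h0]
        · simp only [Fin.mk_one, Pi.smul_apply, smul_eq_mul]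
          rw [div_mul_eq_mul_div, div_eq_iff h0]
          linear_combination -h
    have hj := hx j
    have hb := hbx j
    rw [← hs, evalForm_smul] at hb
    rw [← hs, evalForm_smul, evalForm_smul, hx i] at hj
    refine hij (ht (mul_right_cancel₀ hb ?_))
    linear_combination hj
  have hvals (i : Fin 3) (s r : ℂ) :
      s * evalForm a (r • x i) = t i * (s * evalForm b (r • x i)) := by
    rw [evalForm_smul, evalForm_smul, hx]
    ring
  set g : Matrix (Fin 2) (Fin 2) ℂ := of ![D 2 1 • x 0, D 0 2 • x 1] with hg
  have hdet : g.det ≠ 0 := by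
    have : g.det = D 2 1 * D 0 2 * D 0 1 := by
      simp [hg, det_fin_two, hD]
      ring
    rw [this]
    exact mul_ne_zero (mul_ne_zero (hDne (by decide)) (hDne (by decide))) (hDne (by decide))
  have hg0 : ![1, 0] ᵥ* g = D 2 1 • x 0 := by
    funext k; fin_cases k <;> simp [hg, vecMul, dotProduct]
  have hg1 : ![0, 1] ᵥ* g = D 0 2 • x 1 := by
    funext k; fin_cases k <;> simp [hg, vecMul, dotProduct]
  have hg2 : ![1, 1] ᵥ* g = D 0 1 • x 2 := by
    funext k; fin_cases k <;> simp [hg, vecMul, dotProduct, hD] <;> ring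
  have hne : evalForm b (D 2 1 • x 0) ≠ 0 := by
    rw [evalForm_smul]
    exact mul_ne_zero (pow_ne_zero _ (hDne (by decide))) (hbx 0)
  obtain ⟨v, hv, h1, h2⟩ := exists_GL_pr_eq ⟨(a, b), hab⟩
    (GeneralLinearGroup.mkOfDetNeZero g hdet) (inv_ne_zero hne)
  have hgv : (GeneralLinearGroup.mkOfDetNeZero g hdet).val = g := rfl
  refine ⟨v, hv, defect_eq_of_evalForm_eq (inv_ne_zero hne) _ h1 h2, ?_, ?_, ?_, ?_⟩
  · rw [h1, h2, hgv, hg0]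
    exact hvals ..
  · rw [h1, h2, hgv, hg1]
    exact hvals ..
  · rw [h1, h2, hgv, hg2]
    exact hvals ..
  · rw [h2, hgv, hg0]
    exact inv_mul_cancel₀ hne

end Substitution

theorem exists_injective_affinePoint_notMem {B : Set (Projectivization ℂ (Fin 2 → ℂ))}
    (hB : B.Finite) : ∃ t : Fin 3 → ℂ, Function.Injective t ∧ ∀ i, affinePoint (t i) ∉ B := by
  have h : (affinePoint ⁻¹' B)ᶜ.Infinite :=
    (hB.preimage affinePoint_injective.injOn).infinite_compl
  obtain ⟨e⟩ : Nonempty (Fin 3 ↪ ↥(affinePoint ⁻¹' B)ᶜ) :=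
    ⟨Fin.valEmbedding.trans (Set.Infinite.natEmbedding _ h)⟩
  exact ⟨fun i => e i, Subtype.val_injective.comp e.injective, fun i => (e i).2⟩

end BinaryForms

/-- The Lyashko–Looijenga map has finite fibers on `𝒳_n`: for every prescribed
multiplicity function `ν` on `ℙ¹(ℂ)`, the set of points of `𝒳_n` represented by classes
`[P : Q] ∈ F_n` whose defect function equals `ν` is finite. -/
theorem LL_finite_fibers (n : ℕ) (hn : 1 ≤ n)
    (ν : Projectivization ℂ (Fin 2 → ℂ) → ℕ) :
    { x : Xn n | ∃ u : RatRep n, pr n (Quot.mk (scaleRel n) u) = x ∧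
        ∀ c, defect u.val.1 u.val.2 c = ν c }.Finite := by
  obtain ⟨m, rfl⟩ := Nat.exists_eq_add_of_le' hn
  by_cases hne : ∃ u : RatRep (m + 1), ∀ c, defect u.val.1 u.val.2 c = ν c
  swap
  · exact Set.finite_empty.subset fun x ⟨u, _, hu⟩ => (hne ⟨u, hu⟩).elim
  obtain ⟨u₀, hu₀⟩ := hne
  have hB : {c | ν c ≠ 0}.Finite := by simpa only [hu₀] using u₀.2.finite_defect_ne_zero
  obtain ⟨t, ht, htB⟩ := exists_injective_affinePoint_notMem hB
  have hfin := IsNormalizedPair.finite m (2 * (m + 1)) t hB.toFinset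
    (fun c => (c.rep 0, c.rep 1)) fun c _ h =>
      (rep_one_ne_zero_or c).elim (· (congrArg Prod.snd h)) (· (congrArg Prod.fst h))
  have hinj : Function.Injective
      fun u : RatRep (m + 1) => (formPoly u.val.1, formPoly u.val.2) := fun u v h =>
    Subtype.ext (Prod.ext (formPoly_injective (congrArg Prod.fst h))
      (formPoly_injective (congrArg Prod.snd h)))
  refine ((hfin.preimage hinj.injOn).image fun u => pr _ (Quot.mk _ u)).subset ?_
  rintro _ ⟨u, rfl, hu⟩
  obtain ⟨v, hv, hdef, h₀, h₁, h₂, hb⟩ := exists_normalized u ht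
  have hν c : defect v.val.1 v.val.2 c = ν c := (hdef c).trans (hu c)
  refine ⟨v, v.2.isNormalizedPair (fun i => ?_) h₀ h₁ h₂ hb _ fun c hc => ?_, hv⟩
  · rw [hν]
    exact not_not.1 (htB i)
  · rw [hν] at hc
    simpa using hc
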